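/- For every m ≥ 2, the sequence R_m is a stepping sequence for m. -/

import Mathlib

open List

/-- The initial configuration `(1, 2, …, m)`. -/
def initConfig (m : ℕ) : List ℕ := (List.range m).map (· + 1)

/-- A move at index `i` (with `1 ≤ i ≤ m-1`) transposes the entries `q_i` and `q_{i+1}`
(one-indexed), i.e. the entries at zero-indexed positions `i-1` and `i`. -/
def swapAdj (q : List ℕ) (i : ℕ) : List ℕ :=
  (q.set (i - 1) (q.getD i 0)).set i (q.getD (i - 1) 0)

/-- The prefix set `S_k(q) = {q_1, …, q_k}`. -/
def prefixSet (q : List ℕ) (k : ℕ) : Finset ℕ := (q.take k).toFinset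

/-- The initial prefix sets `S_0 ⊂ S_1 ⊂ … ⊂ S_m` of the configuration `(1,…,m)`. -/
def initSets (m : ℕ) : List (Finset ℕ) :=
  (List.range (m + 1)).map (fun k => prefixSet (initConfig m) k)

/-- The sets generated by applying a sequence of moves starting from configuration `q`:
the `t`-th generated set is the prefix set of length `i_t` of the configuration
obtained after the `t`-th move. -/
def genSetsAux (q : List ℕ) : List ℕ → List (Finset ℕ)
  | [] => []
  | i :: rest => prefixSet (swapAdj q i) i :: genSetsAux (swapAdj q i) rest

/-- The sets generated by the moves, starting from the initial configuration `(1,…,m)`. -/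
def genSets (m : ℕ) (moves : List ℕ) : List (Finset ℕ) :=
  genSetsAux (initConfig m) moves

/-- `moves` is a stepping sequence for `m`: each move index lies in `{1,…,m-1}`, and the
initial prefix sets `S_0,…,S_m` together with the generated sets list every subset of
`{1,…,m}` exactly once. -/
def IsSteppingSeq (m : ℕ) (moves : List ℕ) : Prop :=
  (∀ i ∈ moves, 1 ≤ i ∧ i ≤ m - 1) ∧
  (initSets m ++ genSets m moves).Perm (Finset.Icc 1 m).powerset.toList

/-- `R_2 = [1]` and `R_m = (R_{m-1}+1) ++ [1,2,…,m-1] ++ R_{m-1}` for `m ≥ 3`. -/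
def Rseq : ℕ → List ℕ
  | 0 => []
  | 1 => []
  | 2 => [1]
  | m + 3 => (Rseq (m + 2)).map (· + 1) ++ (List.range (m + 2)).map (· + 1) ++ Rseq (m + 2)

theorem Rseq_succ (n : ℕ) :
    Rseq (n + 1) = (Rseq n).map (· + 1) ++ (List.range n).map (· + 1) ++ Rseq n := by
  match n with
  | 0 => rfl
  | 1 => rfl
  | n + 2 => rfl

theorem mem_Rseq_bounds (n : ℕ) : ∀ i ∈ Rseq n, 1 ≤ i ∧ i < n := by
  induction n with
  | zero => simp [Rseq]
  | succ n ih =>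
    intro i hi
    simp only [Rseq_succ, List.mem_append, List.mem_map, List.mem_range] at hi
    rcases hi with (⟨j, hj, rfl⟩ | ⟨j, hj, rfl⟩) | hi
    · have := ih j hj
      omega
    · omega
    · have := ih i hi
      omega

theorem prefixSet_zero (q : List ℕ) : prefixSet q 0 = ∅ := by
  simp [prefixSet]

theorem prefixSet_cons_succ (x : ℕ) (q : List ℕ) (k : ℕ) :
    prefixSet (x :: q) (k + 1) = insert x (prefixSet q k) := by
  simp [prefixSet]

theorem prefixSet_append_of_le {q : List ℕ} {k : ℕ} (hk : k ≤ q.length) (r : List ℕ) :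
    prefixSet (q ++ r) k = prefixSet q k := by
  simp [prefixSet, List.take_append_of_le_length hk]

theorem length_swapAdj (q : List ℕ) (i : ℕ) : (swapAdj q i).length = q.length := by
  simp [swapAdj]

theorem swapAdj_cons_cons_one (x y : ℕ) (q : List ℕ) :
    swapAdj (x :: y :: q) 1 = y :: x :: q := by
  simp [swapAdj]

theorem swapAdj_cons_succ (x : ℕ) (q : List ℕ) {i : ℕ} (hi : 1 ≤ i) :
    swapAdj (x :: q) (i + 1) = x :: swapAdj q i := by
  obtain ⟨i, rfl⟩ := Nat.exists_eq_add_of_le' hi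
  simp [swapAdj]

theorem swapAdj_append {q : List ℕ} {i : ℕ} (hi : i < q.length) (r : List ℕ) :
    swapAdj (q ++ r) i = swapAdj q i ++ r := by
  have hi' : i - 1 < q.length := by omega
  simp only [swapAdj, List.getD_append _ _ _ _ hi, List.getD_append _ _ _ _ hi']
  rw [List.set_append_left _ _ hi', List.set_append_left _ _ (by simpa using hi)]

theorem swapAdj_perm {q : List ℕ} {i : ℕ} (hi : 1 ≤ i) (hq : i < q.length) :
    (swapAdj q i).Perm q := by
  induction q generalizing i with
  | nil => simp at hq
  | cons x q ih =>
    obtain ⟨i, rfl⟩ := Nat.exists_eq_add_of_le' hi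
    rcases Nat.eq_zero_or_pos i with rfl | h
    · cases q with
      | nil => simp at hq
      | cons y q => simpa [swapAdj_cons_cons_one] using List.Perm.swap x y q
    · rw [swapAdj_cons_succ x q h]
      exact (ih h (by simpa using hq)).cons x

theorem genSetsAux_append (q a b : List ℕ) :
    genSetsAux q (a ++ b) = genSetsAux q a ++ genSetsAux (a.foldl swapAdj q) b := by
  induction a generalizing q with
  | nil => rfl
  | cons i a ih => simp [genSetsAux, ih]

theorem foldl_swapAdj_perm (q l : List ℕ) (hl : ∀ i ∈ l, 1 ≤ i ∧ i < q.length) :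
    (l.foldl swapAdj q).Perm q := by
  induction l generalizing q with
  | nil => rfl
  | cons i l ih =>
    have hi := hl i (by simp)
    refine (ih (swapAdj q i) fun j hj => ?_).trans (swapAdj_perm hi.1 hi.2)
    rw [length_swapAdj]
    exact hl j (by simp [hj])

theorem foldl_swapAdj_cons_map_succ (x : ℕ) (q l : List ℕ) (hl : ∀ i ∈ l, 1 ≤ i) :
    (l.map (· + 1)).foldl swapAdj (x :: q) = x :: l.foldl swapAdj q := by
  induction l generalizing q with
  | nil => rfl
  | cons i l ih =>
    simp only [List.map_cons, List.foldl_cons]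
    rw [swapAdj_cons_succ x q (hl i (by simp)), ih _ fun j hj => hl j (by simp [hj])]

theorem genSetsAux_cons_map_succ (x : ℕ) (q l : List ℕ) (hl : ∀ i ∈ l, 1 ≤ i) :
    genSetsAux (x :: q) (l.map (· + 1)) = (genSetsAux q l).map (insert x) := by
  induction l generalizing q with
  | nil => rfl
  | cons i l ih =>
    simp only [List.map_cons, genSetsAux]
    rw [swapAdj_cons_succ x q (hl i (by simp)), ih _ fun j hj => hl j (by simp [hj]),
      prefixSet_cons_succ]

theorem genSetsAux_append_left (q r l : List ℕ) (hl : ∀ i ∈ l, i < q.length) :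
    genSetsAux (q ++ r) l = genSetsAux q l := by
  induction l generalizing q with
  | nil => rfl
  | cons i l ih =>
    have hi := hl i (by simp)
    simp only [genSetsAux]
    rw [swapAdj_append hi, prefixSet_append_of_le (by rw [length_swapAdj]; exact hi.le), ih]
    intro j hj
    rw [length_swapAdj]
    exact hl j (by simp [hj])

theorem foldl_swapAdj_cons_range (x : ℕ) (q : List ℕ) :
    ((List.range q.length).map (· + 1)).foldl swapAdj (x :: q) = q ++ [x] := by
  induction q with
  | nil => rfl
  | cons y q ih =>
    have h : List.range (q.length + 1) = 0 :: (List.range q.length).map (· + 1) :=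
      List.range_succ_eq_map
    rw [List.length_cons, h, List.map_cons, List.foldl_cons, swapAdj_cons_cons_one,
      foldl_swapAdj_cons_map_succ _ _ _ (by simp), ih]
    rfl

theorem genSetsAux_cons_range (x : ℕ) (q : List ℕ) :
    genSetsAux (x :: q) ((List.range q.length).map (· + 1)) =
      (List.range q.length).map fun k => prefixSet q (k + 1) := by
  induction q with
  | nil => rfl
  | cons y q ih =>
    have h : List.range (q.length + 1) = 0 :: (List.range q.length).map (· + 1) :=
      List.range_succ_eq_map
    rw [List.length_cons, h, List.map_cons, genSetsAux, zero_add, swapAdj_cons_cons_one,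
      genSetsAux_cons_map_succ _ _ _ (by simp), ih]
    simp [prefixSet_cons_succ, prefixSet_zero]

theorem map_prefixSet_range_succ (q : List ℕ) (n : ℕ) :
    (List.range (n + 1)).map (prefixSet q) =
      ∅ :: (List.range n).map fun k => prefixSet q (k + 1) := by
  rw [List.range_succ_eq_map]
  simp [prefixSet_zero, Function.comp_def]

theorem val_powerset_insert {α : Type*} [DecidableEq α] {a : α} {s : Finset α} (ha : a ∉ s) :
    (insert a s).powerset.val = s.powerset.val.map (insert a) + s.powerset.val := by
  have hinj : Set.InjOn (insert a) (s.powerset : Set (Finset α)) := by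
    intro t ht u hu htu
    have ht' : a ∉ t := fun h => ha (Finset.mem_powerset.1 ht h)
    have hu' : a ∉ u := fun h => ha (Finset.mem_powerset.1 hu h)
    rw [← Finset.erase_insert ht', ← Finset.erase_insert hu']
    exact congrArg (Finset.erase · a) htu
  have hdisj : Disjoint s.powerset (s.powerset.image (insert a)) := by
    rw [Finset.disjoint_left]
    intro t ht h
    obtain ⟨u, -, rfl⟩ := Finset.mem_image.1 h
    exact ha (Finset.mem_powerset.1 ht (Finset.mem_insert_self a u))
  rw [Finset.powerset_insert, ← Finset.disjUnion_eq_union _ _ hdisj, Finset.disjUnion_val,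
    Finset.image_val_of_injOn hinj, add_comm]

/-- Applied to any duplicate-free configuration `q` of length `n`, the moves `R_n` generate every
subset of the entries of `q` that is not a prefix set of `q`, exactly once. -/
theorem prefixSets_append_genSetsAux_Rseq (n : ℕ) (q : List ℕ) (hlen : q.length = n)
    (hq : q.Nodup) :
    (((List.range (n + 1)).map (prefixSet q) ++ genSetsAux q (Rseq n) : List (Finset ℕ)) :
      Multiset (Finset ℕ)) = q.toFinset.powerset.val := by
  induction n generalizing q with
  | zero =>
    obtain rfl := List.length_eq_zero_iff.1 hlen
    rfl
  | succ n ih =>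
    obtain ⟨x, q, rfl⟩ := List.exists_cons_of_length_eq_add_one hlen
    obtain ⟨hx, hq⟩ := List.nodup_cons.1 hq
    have hlen : q.length = n := by simpa using hlen
    have hR := mem_Rseq_bounds n
    have hR' : ∀ i ∈ Rseq n, 1 ≤ i := fun i hi => (hR i hi).1
    have hperm : ((Rseq n).foldl swapAdj q).Perm q := foldl_swapAdj_perm q _ (by rwa [hlen])
    have ih_final := ih _ (hperm.length_eq.trans hlen) (hperm.nodup_iff.2 hq)
    rw [List.toFinset_eq_of_perm _ _ hperm] at ih_final
    have hgen : genSetsAux (x :: q) (Rseq (n + 1)) =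
        (genSetsAux q (Rseq n)).map (insert x) ++
          ((List.range n).map (fun k => prefixSet ((Rseq n).foldl swapAdj q) (k + 1)) ++
            genSetsAux ((Rseq n).foldl swapAdj q) (Rseq n)) := by
      have hlen' := hperm.length_eq.trans hlen
      have hsets := genSetsAux_cons_range x ((Rseq n).foldl swapAdj q)
      have hfinal := foldl_swapAdj_cons_range x ((Rseq n).foldl swapAdj q)
      rw [hlen'] at hsets hfinal
      rw [Rseq_succ, List.append_assoc, genSetsAux_append, genSetsAux_cons_map_succ _ _ _ hR',
        foldl_swapAdj_cons_map_succ _ _ _ hR', genSetsAux_append, hsets, hfinal,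
        genSetsAux_append_left _ _ _ fun i hi => hlen'.symm ▸ (hR i hi).2]
    have hpre : (List.range (n + 1)).map (fun k => prefixSet (x :: q) (k + 1)) =
        ((List.range (n + 1)).map (prefixSet q)).map (insert x) := by
      simp [prefixSet_cons_succ, Function.comp_def]
    rw [List.toFinset_cons, val_powerset_insert (by simpa using hx)]
    nth_rw 1 [← ih q hlen hq]
    rw [← ih_final, hgen, map_prefixSet_range_succ, hpre,
      map_prefixSet_range_succ ((Rseq n).foldl swapAdj q) n, Multiset.map_coe, Multiset.coe_add,
      Multiset.coe_eq_coe, List.map_append]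
    simpa only [List.cons_append, List.append_assoc] using
      (List.perm_middle (l₁ := ((List.range (n + 1)).map (prefixSet q)).map (insert x) ++
        (genSetsAux q (Rseq n)).map (insert x))).symm

theorem toFinset_initConfig (m : ℕ) : (initConfig m).toFinset = Finset.Icc 1 m := by
  ext k
  simp only [initConfig, List.mem_toFinset, List.mem_map, List.mem_range, Finset.mem_Icc]
  constructor
  · rintro ⟨j, hj, rfl⟩
    omega
  · rintro ⟨h, h'⟩
    exact ⟨k - 1, by omega, by omega⟩

theorem nodup_initConfig (m : ℕ) : (initConfig m).Nodup :=
  List.nodup_range.map (add_left_injective 1)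

/-- For every `m ≥ 2`, the sequence `R_m` is a stepping sequence for `m`. -/
theorem Rseq_isSteppingSeq (m : ℕ) (hm : 2 ≤ m) : IsSteppingSeq m (Rseq m) := by
  refine ⟨fun i hi => ?_, ?_⟩
  · have := mem_Rseq_bounds m i hi
    omega
  · rw [← Multiset.coe_eq_coe, Finset.coe_toList, ← toFinset_initConfig]
    exact prefixSets_append_genSetsAux_Rseq m _ (by simp [initConfig]) (nodup_initConfig m)
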